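/- For each i ∈ {0,1,2,3,4}, the bijection (α,m) ↦ (rᵢ(α), rᵢ′(m)) of ℝ⁴ × ℂ⁴ maps R̃^full onto itself; equivalently, it maps the arrangement ⋃_{d,e} H_{d,e} ∪ ⋃_{d,i} H_{d,i} onto itself. Consequently R̃^full is invariant under the group generated by the maps (rᵢ, rᵢ′), i = 0,…,4. -/

import Mathlib

open Real

noncomputable section

/-- The normal directions of the five reflections `r₀,…,r₄`. -/
def coefVec : Fin 5 → (Fin 4 → ℝ) :=
  ![![-1, 1, 1, 1], ![1, 1, 1, 1], ![1, 1, -1, -1], ![1, -1, 1, -1], ![1, -1, -1, 1]]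

/-- The affine constants of the five reflections `r₀,…,r₄`. -/
def coefC : Fin 5 → ℝ := ![0, -1, 0, 0, 0]

/-- The reflections `r₀,…,r₄` of `ℝ⁴`. -/
def rr (i : Fin 5) (a : Fin 4 → ℝ) : Fin 4 → ℝ :=
  fun j => a j - ((∑ t : Fin 4, coefVec i t * a t) + coefC i) / 2 * coefVec i j

/-- The `ℂ`-linear maps `r₀′,…,r₄′` (the linear parts of the `rᵢ`, extended `ℂ`-linearly). -/
def rrC (i : Fin 5) (m : Fin 4 → ℂ) : Fin 4 → ℂ :=
  fun j => m j - (∑ t : Fin 4, (coefVec i t : ℂ) * m t) / 2 * (coefVec i j : ℂ)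

/-- The map `(α,m) ↦ (rᵢ(α), rᵢ′(m))` of `ℝ⁴ × ℂ⁴`. -/
def psi (i : Fin 5) (p : (Fin 4 → ℝ) × (Fin 4 → ℂ)) : (Fin 4 → ℝ) × (Fin 4 → ℂ) :=
  (rr i p.1, rrC i p.2)

/-- `H_{d,e}` for `d ∈ ℤ` and `e ∈ {0,1}⁴` (encoded by booleans, `true ↔ eᵢ = 1`). -/
def Hde (d : ℤ) (e : Fin 4 → Bool) : Set ((Fin 4 → ℝ) × (Fin 4 → ℂ)) :=
  {p | (d : ℝ) + ∑ i : Fin 4,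
        ((if e i then (1 : ℝ) else 0) + (if e i then (-1 : ℝ) else 1) * p.1 i) = 0 ∧
       ∑ i : Fin 4, (if e i then (-1 : ℂ) else 1) * p.2 i = 0}

/-- `H_{d,i}` for `d ∈ ℤ` and `i ∈ {1,…,4}`: `2αᵢ = d` and `mᵢ = 0`. -/
def Hdi (d : ℤ) (i : Fin 4) : Set ((Fin 4 → ℝ) × (Fin 4 → ℂ)) :=
  {p | 2 * p.1 i = (d : ℝ) ∧ p.2 i = 0}

/-- The arrangement `⋃_{d,e} H_{d,e} ∪ ⋃_{d,i} H_{d,i}`. -/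
def Arr : Set ((Fin 4 → ℝ) × (Fin 4 → ℂ)) :=
  (⋃ (d : ℤ) (e : Fin 4 → Bool), Hde d e) ∪ ⋃ (d : ℤ) (i : Fin 4), Hdi d i

/-- `R̃^full`: the complement of the arrangement. -/
def Rfull : Set ((Fin 4 → ℝ) × (Fin 4 → ℂ)) := Set.univ \ Arr

/-- The normal directions of the reflections, as integer vectors. -/
def coefVecInt : Fin 5 → (Fin 4 → ℤ) :=
  ![![-1, 1, 1, 1], ![1, 1, 1, 1], ![1, 1, -1, -1], ![1, -1, 1, -1], ![1, -1, -1, 1]]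

/-- The affine constants of the reflections, as integers. -/
def coefCInt : Fin 5 → ℤ := ![0, -1, 0, 0, 0]

/-- The normal vectors of the arrangement: the sign vectors and plus or minus twice the unit vectors. -/
def IsRootVec (w : Fin 4 → ℤ) : Prop :=
  (∃ e : Fin 4 → Bool, w = fun i => if e i then -1 else 1) ∨ ∃ i, w = Pi.single i 2 ∨ w = Pi.single i (-2)

instance : DecidablePred IsRootVec := fun _ => inferInstanceAs (Decidable (_ ∨ _))

lemma coefVec_eq_intCast (i : Fin 5) (t : Fin 4) : coefVec i t = (coefVecInt i t : ℝ) := by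
  fin_cases i <;> fin_cases t <;> simp [coefVec, coefVecInt]

lemma coefC_eq_intCast (i : Fin 5) : coefC i = (coefCInt i : ℝ) := by
  fin_cases i <;> simp [coefC, coefCInt]

lemma sum_coefVecInt_mul_self (i : Fin 5) : ∑ t, coefVecInt i t * coefVecInt i t = 4 := by
  decide +revert

set_option maxRecDepth 100000 in
lemma IsRootVec.exists_reflect {w : Fin 4 → ℤ} (hw : IsRootVec w) (i : Fin 5) :
    ∃ k : ℤ, ∑ t, w t * coefVecInt i t = 2 * k ∧ IsRootVec (w - k • coefVecInt i) := by
  refine ⟨(∑ t, w t * coefVecInt i t) / 2, ?_⟩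
  obtain ⟨e, rfl⟩ | ⟨j, rfl | rfl⟩ := hw
  · revert i e
    decide
  · revert i j
    decide
  · revert i j
    decide

/-- A point lies on the arrangement iff some root takes an integer value on its real part and
vanishes on its complex part. -/
lemma mem_Arr_iff (p : (Fin 4 → ℝ) × (Fin 4 → ℂ)) :
    p ∈ Arr ↔ ∃ w : Fin 4 → ℤ, IsRootVec w ∧ (∃ n : ℤ, ∑ t, (w t : ℝ) * p.1 t = n) ∧
      ∑ t, (w t : ℂ) * p.2 t = 0 := by
  simp only [Arr, Set.mem_union, Set.mem_iUnion]
  constructor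
  · rintro (⟨d, e, h₁, h₂⟩ | ⟨d, i, h₁, h₂⟩)
    · refine ⟨_, Or.inl ⟨e, rfl⟩, ⟨-d - ∑ i, if e i then 1 else 0, ?_⟩, ?_⟩
      · rw [Finset.sum_add_distrib] at h₁
        push_cast
        linarith
      · push_cast
        exact h₂
    · refine ⟨_, Or.inr ⟨i, Or.inl rfl⟩, ⟨d, ?_⟩, ?_⟩
      · simpa [Pi.single_apply] using h₁
      · simpa [Pi.single_apply] using h₂
  · rintro ⟨w, ⟨e, rfl⟩ | ⟨i, rfl | rfl⟩, ⟨n, h₁⟩, h₂⟩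
    · refine Or.inl ⟨-n - ∑ i, if e i then 1 else 0, e, ?_, ?_⟩
      · rw [Finset.sum_add_distrib]
        push_cast at h₁ ⊢
        linarith
      · push_cast at h₂
        exact h₂
    · refine Or.inr ⟨n, i, ?_, ?_⟩
      · simpa [Pi.single_apply] using h₁
      · simpa [Pi.single_apply] using h₂
    · refine Or.inr ⟨-n, i, ?_, ?_⟩
      · push_cast
        rw [← h₁]
        simp [Pi.single_apply]
      · simpa [Pi.single_apply] using h₂

lemma sum_mul_rr (i : Fin 5) (w : Fin 4 → ℤ) (k : ℤ) (hk : ∑ t, w t * coefVecInt i t = 2 * k)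
    (a : Fin 4 → ℝ) :
    ∑ t, (w t : ℝ) * rr i a t =
      ∑ t, ((w - k • coefVecInt i) t : ℝ) * a t - k * coefCInt i := by
  have hk' : ∑ t, (w t : ℝ) * coefVecInt i t = 2 * k := by exact_mod_cast hk
  simp only [rr, coefVec_eq_intCast, coefC_eq_intCast, Fin.sum_univ_four, Pi.sub_apply,
    Pi.smul_apply, smul_eq_mul, Int.cast_sub, Int.cast_mul] at hk' ⊢
  linear_combination (-(coefVecInt i 0 * a 0 + coefVecInt i 1 * a 1 + coefVecInt i 2 * a 2 +
    coefVecInt i 3 * a 3 + coefCInt i) / 2 : ℝ) * hk'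

lemma sum_mul_rrC (i : Fin 5) (w : Fin 4 → ℤ) (k : ℤ) (hk : ∑ t, w t * coefVecInt i t = 2 * k)
    (m : Fin 4 → ℂ) :
    ∑ t, (w t : ℂ) * rrC i m t = ∑ t, ((w - k • coefVecInt i) t : ℂ) * m t := by
  have hk' : ∑ t, (w t : ℂ) * coefVecInt i t = 2 * k := by exact_mod_cast hk
  simp only [rrC, coefVec_eq_intCast, Complex.ofReal_intCast, Fin.sum_univ_four, Pi.sub_apply,
    Pi.smul_apply, smul_eq_mul, Int.cast_sub, Int.cast_mul] at hk' ⊢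
  linear_combination (-(coefVecInt i 0 * m 0 + coefVecInt i 1 * m 1 + coefVecInt i 2 * m 2 +
    coefVecInt i 3 * m 3) / 2 : ℂ) * hk'

lemma psi_involutive (i : Fin 5) : Function.Involutive (psi i) := by
  intro p
  have h := sum_coefVecInt_mul_self i
  have hR : ∑ t, (coefVecInt i t : ℝ) * coefVecInt i t = 4 := by exact_mod_cast h
  have hC : ∑ t, (coefVecInt i t : ℂ) * coefVecInt i t = 4 := by exact_mod_cast h
  ext j
  · simp only [psi, rr, coefVec_eq_intCast, coefC_eq_intCast, Fin.sum_univ_four] at hR ⊢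
    linear_combination ((coefVecInt i 0 * p.1 0 + coefVecInt i 1 * p.1 1 +
      coefVecInt i 2 * p.1 2 + coefVecInt i 3 * p.1 3 + coefCInt i) / 4 * coefVecInt i j : ℝ) * hR
  · simp only [psi, rrC, coefVec_eq_intCast, Complex.ofReal_intCast, Fin.sum_univ_four] at hC ⊢
    linear_combination ((coefVecInt i 0 * p.2 0 + coefVecInt i 1 * p.2 1 +
      coefVecInt i 2 * p.2 2 + coefVecInt i 3 * p.2 3) / 4 * coefVecInt i j : ℂ) * hC

lemma mem_Arr_of_psi_mem {i : Fin 5} {p : (Fin 4 → ℝ) × (Fin 4 → ℂ)} (hp : psi i p ∈ Arr) :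
    p ∈ Arr := by
  obtain ⟨w, hw, ⟨n, h₁⟩, h₂⟩ := (mem_Arr_iff _).1 hp
  obtain ⟨k, hk, hr⟩ := hw.exists_reflect i
  refine (mem_Arr_iff _).2 ⟨_, hr, ⟨n + k * coefCInt i, ?_⟩, ?_⟩
  · have := (sum_mul_rr i w k hk p.1).symm.trans h₁
    push_cast at this ⊢
    linarith
  · exact (sum_mul_rrC i w k hk p.2).symm.trans h₂

lemma psi_image_Arr (i : Fin 5) : psi i '' Arr = Arr := by
  ext p
  rw [Set.mem_image_iff_of_inverse (psi_involutive i).leftInverse (psi_involutive i).rightInverse]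
  exact ⟨mem_Arr_of_psi_mem, fun hp => mem_Arr_of_psi_mem (by rwa [psi_involutive i p])⟩

lemma psi_image_Rfull (i : Fin 5) : psi i '' Rfull = Rfull := by
  rw [Rfull, ← Set.compl_eq_univ_sdiff, Set.image_compl_eq (psi_involutive i).bijective,
    psi_image_Arr]

/-- Each map `(α,m) ↦ (rᵢ(α), rᵢ′(m))` maps `R̃^full` onto itself, equivalently maps the
arrangement onto itself; consequently `R̃^full` is invariant under the group generated by
these maps (which, being generated by involutions, is the monoid they generate inside
`Function.End`). -/
theorem stmt13 :
    (∀ i : Fin 5, psi i '' Rfull = Rfull) ∧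
    (∀ i : Fin 5, psi i '' Arr = Arr) ∧
    (∀ g ∈ Submonoid.closure
        {f : Function.End ((Fin 4 → ℝ) × (Fin 4 → ℂ)) | ∃ i : Fin 5, f = psi i},
      (g : ((Fin 4 → ℝ) × (Fin 4 → ℂ)) → ((Fin 4 → ℝ) × (Fin 4 → ℂ))) '' Rfull = Rfull) := by
  refine ⟨psi_image_Rfull, psi_image_Arr, fun g hg => ?_⟩
  induction hg using Submonoid.closure_induction with
  | mem f hf =>
    obtain ⟨i, rfl⟩ := hf
    exact psi_image_Rfull i
  | one => exact Set.image_id _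
  | mul f g _ _ hf hg => exact (Set.image_comp f g Rfull).trans (by rw [hg, hf])
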